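/- arXiv:2105.00844 — 6 statements merged into one kernel-verified Lean document; each statement's English description precedes it below -/
import Mathlib

section
/- For every k > α, the k-th tail moment of ν is finite if and only if β^{α-k} is λ-integrable: ∫_{‖x‖>1} ‖x‖^k dν(x) < ∞ ⟺ ∫_{S^{d-1}} β(w)^{α-k} λ(dw) < ∞. -/
open MeasureTheory Set

/-- The radial measure `e^{-b r} r^{-α-1} dr` on `(0,∞)`. -/
noncomputable def radialETaS (α b : ℝ) : Measure ℝ :=
  (volume.restrict (Set.Ioi (0:ℝ))).withDensity
    (fun r => ENNReal.ofReal (Real.exp (-b * r) * r ^ (-α - 1)))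

/-- The exponential tempered `α`-stable Lévy measure on `ℝ^d` with spherical
measure `lam` and tempering function `β`:
`ν(E) = ∫_{S^{d-1}} ∫_0^∞ 1_E(r w) e^{-β(w) r} r^{-α-1} dr λ(dw)`. -/
noncomputable def etas (d : ℕ) (α : ℝ) (lam : Measure (EuclideanSpace ℝ (Fin d)))
    (β : EuclideanSpace ℝ (Fin d) → ℝ) : Measure (EuclideanSpace ℝ (Fin d)) :=
  lam.bind (fun w => (radialETaS α (β w)).map (fun r : ℝ => r • w))

lemma radial_upper (b s : ℝ) (hb : 0 < b) (hs : 0 < s) :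
    ∫⁻ r in Ioi (1:ℝ), ENNReal.ofReal (Real.exp (-b * r) * r ^ (s - 1)) ≤
      ENNReal.ofReal (Real.Gamma s) * ENNReal.ofReal (b ^ (-s)) := by
  have h1 := Real.integral_rpow_mul_exp_neg_mul_Ioi hs hb
  have hpos : 0 < (1 / b) ^ s * Real.Gamma s :=
    mul_pos (Real.rpow_pos_of_pos (by positivity) _) (Real.Gamma_pos_of_pos hs)
  have hint : Integrable (fun t : ℝ => t ^ (s - 1) * Real.exp (-(b * t)))
      (volume.restrict (Ioi 0)) := by
    by_contra h
    rw [integral_undef h] at h1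
    exact hpos.ne h1
  calc ∫⁻ r in Ioi (1:ℝ), ENNReal.ofReal (Real.exp (-b * r) * r ^ (s - 1))
      ≤ ∫⁻ r in Ioi (0:ℝ), ENNReal.ofReal (Real.exp (-b * r) * r ^ (s - 1)) :=
        lintegral_mono_set (Ioi_subset_Ioi zero_le_one)
    _ = ∫⁻ r in Ioi (0:ℝ), ENNReal.ofReal (r ^ (s - 1) * Real.exp (-(b * r))) := by
        congr 1; ext r; rw [mul_comm, neg_mul]
    _ = ENNReal.ofReal ((1 / b) ^ s * Real.Gamma s) := by
        rw [← h1, ofReal_integral_eq_lintegral_ofReal hint]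
        filter_upwards [ae_restrict_mem measurableSet_Ioi] with t ht
        exact mul_nonneg (Real.rpow_nonneg (le_of_lt ht) _) (Real.exp_pos _).le
    _ ≤ _ := by
        rw [← ENNReal.ofReal_mul (Real.Gamma_pos_of_pos hs).le, mul_comm, one_div,
          Real.inv_rpow hb.le, Real.rpow_neg hb.le]

lemma radial_lower (b s : ℝ) (hb : 0 < b) (hb1 : b ≤ 1) (hs : 0 < s) :
    ENNReal.ofReal (Real.exp (-2) / 2) * ENNReal.ofReal (b ^ (-s)) ≤
    ∫⁻ r in Ioi (1:ℝ), ENNReal.ofReal (Real.exp (-b * r) * r ^ (s - 1)) := by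
  have h1b : 1 ≤ 1 / b := by rw [le_div_iff₀ hb]; linarith
  calc ENNReal.ofReal (Real.exp (-2) / 2) * ENNReal.ofReal (b ^ (-s))
      = ∫⁻ r in Ioo (1 / b) (2 / b), ENNReal.ofReal (Real.exp (-2) * (b ^ (-s) * (b / 2))) := by
        rw [setLIntegral_const, Real.volume_Ioo, ← ENNReal.ofReal_mul (by positivity),
          ← ENNReal.ofReal_mul (by positivity)]
        congr 1
        field_simp
        ring
    _ ≤ ∫⁻ r in Ioo (1 / b) (2 / b), ENNReal.ofReal (Real.exp (-b * r) * r ^ (s - 1)) := by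
        apply setLIntegral_mono' measurableSet_Ioo
        intro r hr
        have hr0 : 0 < r := by linarith [hr.1]
        have h2 : b * r ≤ 2 := by
          have := (lt_div_iff₀ hb).1 hr.2
          linarith
        apply ENNReal.ofReal_le_ofReal
        apply mul_le_mul _ _ (by positivity) (Real.exp_pos _).le
        · apply Real.exp_le_exp.2; linarith
        · rw [Real.rpow_sub_one hr0.ne', div_eq_mul_inv]
          apply mul_le_mul _ _ (by positivity) (by positivity)
          · rw [Real.rpow_neg hb.le, ← Real.inv_rpow hb.le, ← one_div]
            exact Real.rpow_le_rpow (by positivity) hr.1.le hs.le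
          · rw [← one_div r, le_div_iff₀ hr0]; linarith
    _ ≤ _ := lintegral_mono_set (fun r hr => lt_of_le_of_lt h1b hr.1)

lemma etas_kernel_measurable (d : ℕ) (α : ℝ) (β : EuclideanSpace ℝ (Fin d) → ℝ)
    (hβ : Measurable β) :
    Measurable (fun w : EuclideanSpace ℝ (Fin d) =>
      (radialETaS α (β w)).map (fun r : ℝ => r • w)) := by
  apply Measure.measurable_of_measurable_coe
  intro E hE
  have hm : ∀ w : EuclideanSpace ℝ (Fin d), Measurable (fun r : ℝ => r • w) :=
    fun w => by fun_prop
  have : (fun w : EuclideanSpace ℝ (Fin d) =>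
      ((radialETaS α (β w)).map (fun r : ℝ => r • w)) E) = fun w =>
      ∫⁻ r in Ioi (0:ℝ), ({p : EuclideanSpace ℝ (Fin d) × ℝ | p.2 • p.1 ∈ E}.indicator
        (fun p => ENNReal.ofReal (Real.exp (-(β p.1) * p.2) * p.2 ^ (-α - 1)))) (w, r) := by
    ext w
    rw [Measure.map_apply (hm w) hE, radialETaS, withDensity_apply _ (hm w hE),
      ← lintegral_indicator (hm w hE)]
    rfl
  rw [this]
  apply Measurable.lintegral_prod_right'
  apply Measurable.indicator
  · fun_prop
  · exact (show Measurable (fun p : EuclideanSpace ℝ (Fin d) × ℝ => p.2 • p.1) by fun_prop) hE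

lemma etas_inner (d : ℕ) (α k b : ℝ) (w : EuclideanSpace ℝ (Fin d)) (hw : ‖w‖ = 1) :
    ∫⁻ x, {x : EuclideanSpace ℝ (Fin d) | 1 < ‖x‖}.indicator
      (fun x => ENNReal.ofReal (‖x‖ ^ k)) x ∂((radialETaS α b).map (fun r : ℝ => r • w)) =
    ∫⁻ r in Ioi (1:ℝ), ENNReal.ofReal (Real.exp (-b * r) * r ^ ((k - α) - 1)) := by
  have hS : MeasurableSet {x : EuclideanSpace ℝ (Fin d) | 1 < ‖x‖} :=
    measurableSet_lt measurable_const measurable_norm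
  have hg : Measurable ({x : EuclideanSpace ℝ (Fin d) | 1 < ‖x‖}.indicator
      (fun x => ENNReal.ofReal (‖x‖ ^ k))) := Measurable.indicator (by fun_prop) hS
  have hm : Measurable (fun r : ℝ => r • w) := by fun_prop
  have hgm : Measurable (fun r : ℝ => {x : EuclideanSpace ℝ (Fin d) | 1 < ‖x‖}.indicator
      (fun x => ENNReal.ofReal (‖x‖ ^ k)) (r • w)) := hg.comp hm
  rw [lintegral_map hg hm, radialETaS,
    lintegral_withDensity_eq_lintegral_mul _ (by fun_prop) hgm,
    ← lintegral_indicator measurableSet_Ioi, ← lintegral_indicator measurableSet_Ioi]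
  congr 1
  ext r
  by_cases h0 : 0 < r
  · by_cases h1 : 1 < r
    · have h2 : r • w ∈ {x : EuclideanSpace ℝ (Fin d) | 1 < ‖x‖} := by
        simp [norm_smul, hw, abs_of_pos h0, h1]
      rw [indicator_of_mem (show r ∈ Ioi (0:ℝ) from h0),
        indicator_of_mem (show r ∈ Ioi (1:ℝ) from h1)]
      simp only [Pi.mul_apply]
      rw [indicator_of_mem h2, ← ENNReal.ofReal_mul (by positivity), norm_smul, hw, mul_one,
        Real.norm_of_nonneg h0.le, mul_assoc, ← Real.rpow_add h0]
      congr 3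
      ring
    · have h2 : r • w ∉ {x : EuclideanSpace ℝ (Fin d) | 1 < ‖x‖} := by
        simpa [norm_smul, hw, abs_of_pos h0] using h1
      rw [indicator_of_mem (show r ∈ Ioi (0:ℝ) from h0),
        indicator_of_notMem (show r ∉ Ioi (1:ℝ) from h1)]
      simp only [Pi.mul_apply]
      rw [indicator_of_notMem h2, mul_zero]
  · rw [indicator_of_notMem (show r ∉ Ioi (0:ℝ) from h0),
      indicator_of_notMem (show r ∉ Ioi (1:ℝ) from fun h => h0 (zero_lt_one.trans h))]

/-- for every `k > α`, the `k`-th tail moment of `ν` is finite iff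
`β^{α-k}` is `λ`-integrable: `∫_{‖x‖>1} ‖x‖^k dν < ∞ ↔ ∫_{S^{d-1}} β(w)^{α-k} dλ(w) < ∞`. -/
theorem etas_tailMoment_gt_alpha_iff
    (d : ℕ) (hd : 1 ≤ d) (α : ℝ) (hα : α ∈ Set.Ioo (0:ℝ) 2)
    (lam : Measure (EuclideanSpace ℝ (Fin d))) [IsFiniteMeasure lam]
    (hlam : lam (Metric.sphere (0 : EuclideanSpace ℝ (Fin d)) 1)ᶜ = 0)
    (β : EuclideanSpace ℝ (Fin d) → ℝ) (hβ : Measurable β)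
    (hβpos : ∀ w ∈ Metric.sphere (0 : EuclideanSpace ℝ (Fin d)) 1, 0 < β w) :
    ∀ k : ℝ, α < k →
      ((∫⁻ x in {x : EuclideanSpace ℝ (Fin d) | 1 < ‖x‖}, ENNReal.ofReal (‖x‖ ^ k)
          ∂(etas d α lam β)) < ⊤ ↔
        (∫⁻ w in Metric.sphere (0 : EuclideanSpace ℝ (Fin d)) 1,
          ENNReal.ofReal (β w ^ (α - k)) ∂lam) < ⊤) := by
  intro k hk
  have hs : 0 < k - α := by linarith
  have hS : MeasurableSet {x : EuclideanSpace ℝ (Fin d) | 1 < ‖x‖} :=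
    measurableSet_lt measurable_const measurable_norm
  have hg : Measurable ({x : EuclideanSpace ℝ (Fin d) | 1 < ‖x‖}.indicator
      (fun x => ENNReal.ofReal (‖x‖ ^ k))) := Measurable.indicator (by fun_prop) hS
  have hsph : MeasurableSet (Metric.sphere (0 : EuclideanSpace ℝ (Fin d)) 1) :=
    Metric.isClosed_sphere.measurableSet
  have hrestr : lam.restrict (Metric.sphere (0 : EuclideanSpace ℝ (Fin d)) 1) = lam :=
    Measure.restrict_eq_self_of_ae_mem (by rw [ae_iff]; exact hlam)
  have hL : (∫⁻ x in {x : EuclideanSpace ℝ (Fin d) | 1 < ‖x‖}, ENNReal.ofReal (‖x‖ ^ k)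
      ∂(etas d α lam β)) = ∫⁻ w in Metric.sphere (0 : EuclideanSpace ℝ (Fin d)) 1,
        (∫⁻ r in Ioi (1:ℝ), ENNReal.ofReal (Real.exp (-(β w) * r) * r ^ ((k - α) - 1))) ∂lam := by
    rw [← lintegral_indicator hS, etas,
      Measure.lintegral_bind (etas_kernel_measurable d α β hβ).aemeasurable hg.aemeasurable]
    conv_lhs => rw [← hrestr]
    apply setLIntegral_congr_fun hsph
    intro w hw
    exact etas_inner d α k (β w) w (by simpa using hw)
  have hneg : α - k = -(k - α) := by ring
  rw [hL, hneg]
  constructor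
  · intro h
    have hc : ENNReal.ofReal (Real.exp (-2) / 2) ≠ 0 := by
      rw [Ne, ENNReal.ofReal_eq_zero, not_le]; positivity
    have hle : ENNReal.ofReal (Real.exp (-2) / 2) *
        (∫⁻ w in Metric.sphere (0 : EuclideanSpace ℝ (Fin d)) 1,
          ENNReal.ofReal (β w ^ (-(k - α))) ∂lam) ≤
        (∫⁻ w in Metric.sphere (0 : EuclideanSpace ℝ (Fin d)) 1,
          ((∫⁻ r in Ioi (1:ℝ), ENNReal.ofReal (Real.exp (-(β w) * r) * r ^ ((k - α) - 1))) +
            ENNReal.ofReal (Real.exp (-2) / 2)) ∂lam) := by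
      rw [← lintegral_const_mul' _ _ ENNReal.ofReal_ne_top]
      apply setLIntegral_mono' hsph
      intro w hw
      rcases le_total (β w) 1 with h1 | h1
      · exact (radial_lower _ _ (hβpos w hw) h1 hs).trans le_self_add
      · refine le_trans ?_ le_add_self
        have : ENNReal.ofReal (β w ^ (-(k - α))) ≤ 1 := by
          rw [ENNReal.ofReal_le_one]
          exact Real.rpow_le_one_of_one_le_of_nonpos h1 (by linarith)
        exact (mul_le_mul_right this _).trans (mul_one _).le
    rw [lintegral_add_right _ measurable_const] at hle
    have hfin := lt_of_le_of_lt hle (ENNReal.add_lt_top.2 ⟨h, by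
      rw [lintegral_const]
      exact ENNReal.mul_lt_top ENNReal.ofReal_lt_top (measure_lt_top _ _)⟩)
    exact ENNReal.lt_top_of_mul_ne_top_right hfin.ne hc
  · intro h
    refine lt_of_le_of_lt (setLIntegral_mono' hsph
      (fun w hw => radial_upper (β w) (k - α) (hβpos w hw) hs)) ?_
    rw [lintegral_const_mul' _ _ ENNReal.ofReal_ne_top]
    exact ENNReal.mul_lt_top ENNReal.ofReal_lt_top h
end

section
/- For α ∈ (0,1), β > 0 and z ∈ ℝ, the function r ↦ (e^{izr} − 1) e^{−βr} r^{−α−1} is Bochner integrable on (0,∞) with values in ℂ, and ∫_0^∞ (e^{izr} − 1) e^{−βr} r^{−α−1} dr = Γ(−α) · ((β − iz)^α − β^α), where the complex powers are taken with the principal branch (well defined since Re(β − iz) = β > 0). -/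
open MeasureTheory Set Complex

/-- real dominating function is integrable -/
lemma etas_aux_dom (α β : ℝ) (hα : α ∈ Set.Ioo (0:ℝ) 1) (hβ : 0 < β) :
    IntegrableOn (fun r : ℝ => r ^ (-α) * Real.exp (-β * r)) (Set.Ioi 0) volume := by
  have h := integrableOn_rpow_mul_exp_neg_mul_rpow (s := -α) (p := 1) (b := β)
    (by linarith [hα.2]) one_pos hβ
  simpa using h

lemma etas_aux_bd (z r : ℝ) (hr : 0 ≤ r) :
    ‖Complex.exp (Complex.I * z * r) - 1‖ ≤ |z| * r := by
  have h := Real.norm_exp_I_mul_ofReal_sub_one_le (x := z * r)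
  rw [Real.norm_eq_abs, abs_mul, abs_of_nonneg hr] at h
  simpa [mul_assoc] using h

lemma etas_aux_meas (c : ℂ) (β s : ℝ) : Measurable (fun r : ℝ =>
        (Complex.exp (c * r) - 1) *
          ((Real.exp (-β * r) * r ^ s : ℝ) : ℂ)) := by
  fun_prop

lemma etas_aux_int (α β z : ℝ) (hα : α ∈ Set.Ioo (0:ℝ) 1)
    (hβ : 0 < β) :
    IntegrableOn (fun r : ℝ =>
        (Complex.exp (Complex.I * z * r) - 1) *
          ((Real.exp (-β * r) * r ^ (-α - 1) : ℝ) : ℂ)) (Set.Ioi 0) volume := by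
  refine Integrable.mono' ((etas_aux_dom α β hα hβ).const_mul |z|)
    (etas_aux_meas (Complex.I * z) β (-α - 1)).aestronglyMeasurable ?_
  refine (ae_restrict_iff' measurableSet_Ioi).2 (Filter.Eventually.of_forall fun r hr => ?_)
  have hr : 0 < r := hr
  rw [norm_mul, Complex.norm_real, Real.norm_of_nonneg (by positivity)]
  refine (mul_le_mul_of_nonneg_right (etas_aux_bd z r hr.le) (by positivity)).trans_eq ?_
  rw [Real.rpow_sub_one hr.ne']
  field_simp

lemma etas_aux_cint (α : ℝ) (hα : α ∈ Set.Ioo (0:ℝ) 1) (a : ℂ) (ha : 0 < a.re) :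
    IntegrableOn (fun r : ℝ => ((r ^ (-α) : ℝ) : ℂ) * Complex.exp (-a * r)) (Set.Ioi 0) volume := by
  refine Integrable.mono' (etas_aux_dom α a.re hα ha)
    (by fun_prop) ?_
  refine (ae_restrict_iff' measurableSet_Ioi).2 (Filter.Eventually.of_forall fun r hr => ?_)
  have hr : 0 < r := hr
  rw [norm_mul, Complex.norm_real, Real.norm_of_nonneg (by positivity), Complex.norm_exp]
  simp

lemma etas_aux_diff (α : ℝ) (hα : α ∈ Set.Ioo (0:ℝ) 1) (a : ℂ) (ha : 0 < a.re) :
    DifferentiableAt ℂ (fun a : ℂ => ∫ r in Set.Ioi (0:ℝ),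
      ((r ^ (-α) : ℝ) : ℂ) * Complex.exp (-a * r)) a := by
  have hb : IntegrableOn (fun r : ℝ => r ^ (1 - α) * Real.exp (-(a.re / 2) * r))
      (Set.Ioi 0) volume := by
    have h := integrableOn_rpow_mul_exp_neg_mul_rpow (s := 1 - α) (p := 1) (b := a.re / 2)
      (by linarith [hα.2]) one_pos (by linarith)
    simpa using h
  have hs : {x : ℂ | a.re / 2 < x.re} ∈ nhds a :=
    (isOpen_lt continuous_const Complex.continuous_re).mem_nhds (by simp; linarith)
  refine (hasDerivAt_integral_of_dominated_loc_of_deriv_le (μ := volume.restrict (Ioi (0:ℝ)))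
    (F := fun (a : ℂ) (r : ℝ) => ((r ^ (-α) : ℝ) : ℂ) * Complex.exp (-a * r))
    (F' := fun (a : ℂ) (r : ℝ) => ((r ^ (-α) : ℝ) : ℂ) * (Complex.exp (-a * r) * (-r)))
    hs (Filter.Eventually.of_forall fun x => by fun_prop) (etas_aux_cint α hα a ha)
    (by fun_prop) ?_ hb ?_).2.differentiableAt
  · refine (ae_restrict_iff' measurableSet_Ioi).2 (Filter.Eventually.of_forall fun r hr x hx => ?_)
    have hr : 0 < r := hr
    have hx : a.re / 2 < x.re := hx
    rw [norm_mul, norm_mul, norm_neg, Complex.norm_real, Complex.norm_real,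
      Real.norm_of_nonneg (by positivity), Real.norm_of_nonneg hr.le, Complex.norm_exp,
      sub_eq_add_neg, Real.rpow_add hr, Real.rpow_one]
    have : (-x * (r : ℂ)).re ≤ -(a.re / 2) * r := by
      simp only [Complex.mul_re, Complex.neg_re, Complex.ofReal_re, Complex.ofReal_im,
        mul_zero, sub_zero]
      nlinarith
    calc r ^ (-α) * (Real.exp (-x * (r : ℂ)).re * r)
        ≤ r ^ (-α) * (Real.exp (-(a.re / 2) * r) * r) := by gcongr
      _ = _ := by ring
  · refine Filter.Eventually.of_forall fun r x _ => ?_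
    have h := (((hasDerivAt_id x).neg.mul_const (r : ℂ)).cexp).const_mul ((r ^ (-α) : ℝ) : ℂ)
    simpa using h

lemma etas_aux_val_real (α : ℝ) (hα : α ∈ Set.Ioo (0:ℝ) 1) (b : ℝ) (hb : 0 < b) :
    (b : ℂ) * ∫ r in Set.Ioi (0:ℝ), ((r ^ (-α) : ℝ) : ℂ) * Complex.exp (-(b : ℂ) * r)
      = (Real.Gamma (1 - α) : ℂ) * (b : ℂ) ^ (α : ℂ) := by
  have h := Complex.integral_cpow_mul_exp_neg_mul_Ioi (a := (1 - α : ℂ)) (r := b)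
    (by simpa using hα.2) hb
  have e : ∫ r in Set.Ioi (0:ℝ), ((r ^ (-α) : ℝ) : ℂ) * Complex.exp (-(b : ℂ) * r)
      = ∫ t in Set.Ioi (0:ℝ), (t : ℂ) ^ ((1 - α : ℂ) - 1) * Complex.exp (-(b * t)) := by
    refine setIntegral_congr_fun measurableSet_Ioi fun r hr => ?_
    have hr : 0 < r := hr
    change ((r ^ (-α) : ℝ) : ℂ) * Complex.exp (-(b : ℂ) * r)
      = (r : ℂ) ^ ((1 - α : ℂ) - 1) * Complex.exp (-(b * r))
    rw [Complex.ofReal_cpow hr.le, neg_mul]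
    congr 2
    push_cast; ring
  have hb0 : (b : ℂ) ≠ 0 := by exact_mod_cast hb.ne'
  have harg : (b : ℂ).arg ≠ Real.pi := by
    rw [Complex.arg_ofReal_of_nonneg hb.le]; exact Real.pi_pos.ne
  rw [e, h, one_div, Complex.inv_cpow _ _ harg, Complex.cpow_sub _ _ hb0, Complex.cpow_one,
    ← Complex.Gamma_ofReal]
  have : (b : ℂ) ^ (α : ℂ) ≠ 0 := by simp [Complex.cpow_eq_zero_iff, hb0]
  push_cast
  field_simp

lemma etas_aux_val (α : ℝ) (hα : α ∈ Set.Ioo (0:ℝ) 1) (a : ℂ) (ha : 0 < a.re) :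
    a * ∫ r in Set.Ioi (0:ℝ), ((r ^ (-α) : ℝ) : ℂ) * Complex.exp (-a * r)
      = (Real.Gamma (1 - α) : ℂ) * a ^ (α : ℂ) := by
  have hU : IsOpen {x : ℂ | 0 < x.re} := isOpen_lt continuous_const Complex.continuous_re
  have hf : AnalyticOnNhd ℂ (fun a : ℂ => a * ∫ r in Set.Ioi (0:ℝ),
      ((r ^ (-α) : ℝ) : ℂ) * Complex.exp (-a * r)) {x : ℂ | 0 < x.re} :=
    DifferentiableOn.analyticOnNhd (fun x hx =>
      (differentiableAt_id.mul (etas_aux_diff α hα x hx)).differentiableWithinAt) hU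
  have hg : AnalyticOnNhd ℂ (fun a : ℂ => (Real.Gamma (1 - α) : ℂ) * a ^ (α : ℂ))
      {x : ℂ | 0 < x.re} :=
    DifferentiableOn.analyticOnNhd (fun x hx =>
      ((differentiableAt_id.cpow_const (Or.inl hx)).const_mul _).differentiableWithinAt) hU
  refine hf.eqOn_of_preconnected_of_frequently_eq hg
    (convex_halfSpace_re_gt 0).isPreconnected (z₀ := 1) (by simp) ?_ ha
  have ht : Filter.Tendsto (fun x : ℝ => (x : ℂ)) (nhdsWithin 1 {1}ᶜ)
      (nhdsWithin 1 {1}ᶜ) := by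
    refine tendsto_nhdsWithin_of_tendsto_nhds_of_eventually_within _ ?_ ?_
    · have := (Complex.continuous_ofReal.tendsto 1).mono_left (nhdsWithin_le_nhds (s := {1}ᶜ))
      simpa using this
    · filter_upwards [self_mem_nhdsWithin] with x hx
      have hx : x ≠ 1 := hx
      change (x : ℂ) ≠ 1
      exact_mod_cast hx
  refine ht.frequently (Filter.Eventually.frequently ?_)
  filter_upwards [nhdsWithin_le_nhds (lt_mem_nhds (zero_lt_one' ℝ))] with x hx
  exact etas_aux_val_real α hα x hx

/-- for `α ∈ (0,1)`, `β > 0`, `z ∈ ℝ`, the function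
`r ↦ (e^{izr} − 1) e^{−βr} r^{−α−1}` is Bochner integrable on `(0,∞)` and
`∫_0^∞ (e^{izr} − 1) e^{−βr} r^{−α−1} dr = Γ(−α)·((β − iz)^α − β^α)`
(principal-branch complex powers). -/
theorem etas_charExponent_alpha_lt_one (α β z : ℝ) (hα : α ∈ Set.Ioo (0:ℝ) 1)
    (hβ : 0 < β) :
    IntegrableOn (fun r : ℝ =>
        (Complex.exp (Complex.I * z * r) - 1) *
          ((Real.exp (-β * r) * r ^ (-α - 1) : ℝ) : ℂ)) (Set.Ioi 0) volume ∧
    (∫ r in Set.Ioi (0:ℝ),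
        (Complex.exp (Complex.I * z * r) - 1) *
          ((Real.exp (-β * r) * r ^ (-α - 1) : ℝ) : ℂ))
      = (Real.Gamma (-α) : ℂ) *
          (((β : ℂ) - z * Complex.I) ^ (α : ℂ) - (β : ℂ) ^ (α : ℂ)) := by
  refine ⟨etas_aux_int α β z hα hβ, ?_⟩
  obtain ⟨h0, h1⟩ := hα
  have hα : α ∈ Set.Ioo (0:ℝ) 1 := ⟨h0, h1⟩
  have hf := etas_aux_int α β z hα hβ
  set a : ℂ := (β : ℂ) - z * Complex.I with ha
  have hare : 0 < a.re := by simpa [ha] using hβ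
  have hbre : 0 < (β : ℂ).re := by simpa using hβ
  have ia := etas_aux_cint α hα a hare
  have ib := etas_aux_cint α hα (β : ℂ) hbre
  have va := etas_aux_val α hα a hare
  have vb := etas_aux_val α hα (β : ℂ) hbre
  let F : ℝ → ℂ := fun r => (Complex.exp (-a * r) - Complex.exp (-(β : ℂ) * r)) *
    ((r ^ (-α) : ℝ) : ℂ)
  have hF0 : F 0 = 0 := by simp [F]
  have hfac : ∀ r : ℝ, Complex.exp (-a * r) - Complex.exp (-(β : ℂ) * r)
      = (Complex.exp (Complex.I * z * r) - 1) * ((Real.exp (-β * r) : ℝ) : ℂ) := by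
    intro r
    rw [sub_mul, one_mul, Complex.ofReal_exp, ← Complex.exp_add, ha]
    congr 2
    · push_cast; ring
    · push_cast; ring
  have hFb : ∀ r : ℝ, 0 ≤ r → ‖F r‖ ≤ |z| * (r ^ (1 - α) * Real.exp (-β * r)) := by
    intro r hr
    rcases hr.eq_or_lt with rfl | hr
    · rw [hF0]; simp; positivity
    simp only [F]
    rw [hfac, norm_mul, norm_mul, Complex.norm_real, Complex.norm_real,
      Real.norm_of_nonneg (by positivity), Real.norm_of_nonneg (by positivity)]
    calc _ ≤ |z| * r * Real.exp (-β * r) * r ^ (-α) := by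
          gcongr; exact etas_aux_bd z r hr.le
      _ = _ := by
          rw [sub_eq_add_neg, Real.rpow_add hr, Real.rpow_one]; ring
  have hcont : ContinuousWithinAt F (Ici 0) 0 := by
    rw [ContinuousWithinAt, hF0]
    refine squeeze_zero_norm' (a := fun r : ℝ => |z| * (r ^ (1 - α) * Real.exp (-β * r))) ?_ ?_
    · filter_upwards [self_mem_nhdsWithin] with r hr using hFb r hr
    · have : Continuous (fun r : ℝ => |z| * (r ^ (1 - α) * Real.exp (-β * r))) := by
        have := Real.continuous_rpow_const (q := 1 - α) (by linarith)
        fun_prop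
      have h := (this.tendsto 0).mono_left (nhdsWithin_le_nhds (s := Ici 0))
      simpa [Real.zero_rpow (by linarith : (1 - α) ≠ 0)] using h
  have htop : Filter.Tendsto F Filter.atTop (nhds 0) := by
    refine squeeze_zero_norm' (a := fun r : ℝ => |z| * (r ^ (1 - α) * Real.exp (-β * r))) ?_ ?_
    · filter_upwards [Filter.eventually_ge_atTop 0] with r hr using hFb r hr
    · simpa using (tendsto_rpow_mul_exp_neg_mul_atTop_nhds_zero (1 - α) β hβ).const_mul |z|
  have hder : ∀ r ∈ Ioi (0:ℝ), HasDerivAt F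
      (-a * (((r ^ (-α) : ℝ) : ℂ) * Complex.exp (-a * r))
        + (β : ℂ) * (((r ^ (-α) : ℝ) : ℂ) * Complex.exp (-(β:ℂ) * r))
        + (-α : ℂ) * ((Complex.exp (Complex.I * z * r) - 1) *
          ((Real.exp (-β * r) * r ^ (-α - 1) : ℝ) : ℂ))) r := by
    intro r hr
    have hr : 0 < r := hr
    have he : ∀ c : ℂ, HasDerivAt (fun r : ℝ => Complex.exp (-c * r))
        (Complex.exp (-c * r) * (-c)) r := by
      intro c
      have := ((hasDerivAt_id (r : ℂ)).const_mul (-c)).cexp.comp_ofReal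
      simpa using this
    have hp := (Real.hasDerivAt_rpow_const (x := r) (p := -α) (Or.inl hr.ne')).ofReal_comp
    have := ((he a).sub (he β)).mul hp
    refine this.congr_deriv ?_
    simp only [Pi.sub_apply]
    rw [Complex.ofReal_mul (Real.exp _), ← mul_assoc (_ - 1), ← hfac]
    push_cast
    ring
  have hI := integral_Ioi_of_hasDerivAt_of_tendsto hcont hder
    (((ia.const_mul (-a)).add (ib.const_mul (β:ℂ))).add (hf.const_mul (-α : ℂ))) htop
  have iab : IntegrableOn (fun r : ℝ => -a * (((r ^ (-α) : ℝ) : ℂ) * Complex.exp (-a * r))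
        + (β : ℂ) * (((r ^ (-α) : ℝ) : ℂ) * Complex.exp (-(β:ℂ) * r))) (Ioi 0) volume :=
    (ia.const_mul (-a)).add (ib.const_mul (β:ℂ))
  rw [integral_add iab (hf.const_mul (-α : ℂ)),
    integral_add (ia.const_mul (-a)) (ib.const_mul (β:ℂ)), integral_const_mul,
    integral_const_mul, integral_const_mul, hF0, neg_mul, va, vb] at hI
  have hG : Real.Gamma (1 - α) = -α * Real.Gamma (-α) := by
    rw [← Real.Gamma_add_one (by linarith)]; congr 1; ring
  rw [hG] at hI
  have hα0 : (α : ℂ) ≠ 0 := by exact_mod_cast h0.ne'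
  apply mul_left_cancel₀ hα0
  push_cast at hI ⊢
  linear_combination -hI
end

section
/- For β > 0 and z ∈ ℝ, the function r ↦ (e^{izr} − 1 − izr) e^{−βr} r^{−2} is Bochner integrable on (0,∞) with values in ℂ, and ∫_0^∞ (e^{izr} − 1 − izr) e^{−βr} r^{−2} dr = (β − iz) · (Log(β − iz) − Log β) + iz, where Log is the principal branch of the complex logarithm (well defined since Re(β − iz) = β > 0). -/
open MeasureTheory Set Complex

lemma etas_bd (x : ℝ) : ‖cexp (I * x) - 1 - I * x‖ ≤ x ^ 2 := by
  have key := Convex.norm_image_sub_le_of_norm_hasDerivWithin_le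
    (f := fun t : ℝ => cexp (I * t) - 1 - I * t) (f' := fun t : ℝ => I * (cexp (I * t) - 1))
    (C := |x|) (s := Metric.closedBall (0:ℝ) |x|) (x := 0) (y := x)
    (fun t ht => by
      have h : HasDerivAt (fun t : ℝ => I * (t:ℂ)) I t := by
        simpa using (Complex.ofRealCLM.hasDerivAt (x := t)).const_mul I
      have := ((h.cexp.sub_const 1).sub h)
      refine HasDerivAt.hasDerivWithinAt ?_
      exact this.congr_deriv (by ring))
    (fun t ht => by
      rw [norm_mul, norm_I, one_mul]
      refine Real.norm_exp_I_mul_ofReal_sub_one_le.trans ?_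
      simpa using ht)
    (convex_closedBall _ _) (by simp) (by simp)
  simpa [← sq] using key

lemma etas_D (r z : ℝ) : HasDerivAt (fun z : ℝ => I * (z:ℂ) * r) (I * r) z := by
  simpa using ((Complex.ofRealCLM.hasDerivAt (x := z)).const_mul I).mul_const (r:ℂ)

lemma etas_exp (β : ℝ) (hβ : 0 < β) (C : ℝ) :
    IntegrableOn (fun r : ℝ => C * Real.exp (-β * r)) (Ioi 0) volume :=
  (integrableOn_exp_mul_Ioi (by linarith) 0).const_mul C

lemma etas_cast (z r : ℝ) : I * (z:ℂ) * r = I * ((z * r : ℝ) : ℂ) := by push_cast; ring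

lemma etas_bd1 (β z r : ℝ) (hr : 0 < r) :
    ‖(cexp (I * z * r) - 1) * ((Real.exp (-β * r) * r⁻¹ : ℝ) : ℂ)‖
      ≤ |z| * Real.exp (-β * r) := by
  rw [norm_mul, etas_cast, Complex.norm_real, Real.norm_of_nonneg (by positivity)]
  have := Real.norm_exp_I_mul_ofReal_sub_one_le (x := z * r)
  rw [Real.norm_eq_abs, abs_mul, abs_of_pos hr] at this
  calc _ ≤ (|z| * r) * (Real.exp (-β * r) * r⁻¹) := by gcongr
    _ = _ := by field_simp

lemma etas_bd0 (β z r : ℝ) (hr : 0 < r) :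
    ‖(cexp (I * z * r) - 1 - I * z * r) * ((Real.exp (-β * r) * r ^ (-2 : ℝ) : ℝ) : ℂ)‖
      ≤ z ^ 2 * Real.exp (-β * r) := by
  have h2 : r ^ (-2 : ℝ) = (r ^ 2)⁻¹ := by
    rw [Real.rpow_neg hr.le]; norm_cast
  rw [norm_mul, etas_cast, Complex.norm_real, Real.norm_of_nonneg (by positivity), h2]
  calc _ ≤ (z * r) ^ 2 * (Real.exp (-β * r) * (r ^ 2)⁻¹) := by
        gcongr; exact etas_bd _
    _ = _ := by field_simp

lemma etas_int1 (β z : ℝ) (hβ : 0 < β) : IntegrableOn (fun r : ℝ =>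
    (cexp (I * z * r) - 1) * ((Real.exp (-β * r) * r⁻¹ : ℝ) : ℂ)) (Ioi 0) volume := by
  refine Integrable.mono' (etas_exp β hβ |z|) (by measurability) ?_
  filter_upwards [ae_restrict_mem measurableSet_Ioi] with r hr using etas_bd1 β z r hr

lemma etas_int0 (β z : ℝ) (hβ : 0 < β) : IntegrableOn (fun r : ℝ =>
    (cexp (I * z * r) - 1 - I * z * r) *
      ((Real.exp (-β * r) * r ^ (-2 : ℝ) : ℝ) : ℂ)) (Ioi 0) volume := by
  refine Integrable.mono' (etas_exp β hβ (z ^ 2)) (by measurability) ?_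
  filter_upwards [ae_restrict_mem measurableSet_Ioi] with r hr using etas_bd0 β z r hr

lemma etas_lap (β z : ℝ) (hβ : 0 < β) :
    ∫ r in Ioi (0:ℝ), I * cexp (I * z * r) * ((Real.exp (-β * r) : ℝ) : ℂ)
      = I / (β - z * I) := by
  have h := integral_exp_mul_complex_Ioi (a := -(β - z * I)) (by simpa using hβ) 0
  have e : ∀ r : ℝ, I * cexp (I * z * r) * ((Real.exp (-β * r) : ℝ) : ℂ)
      = I * cexp (-(β - z * I) * r) := fun r => by
    rw [mul_assoc, Complex.ofReal_exp, ← Complex.exp_add]; congr 2; push_cast; ring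
  simp_rw [e]
  rw [integral_const_mul, h]
  simp only [ofReal_zero, mul_zero, Complex.exp_zero, neg_div_neg_eq]
  ring

lemma etas_der1 (β z : ℝ) (hβ : 0 < β) : HasDerivAt (fun z : ℝ => ∫ r in Ioi (0:ℝ),
    (cexp (I * z * r) - 1) * ((Real.exp (-β * r) * r⁻¹ : ℝ) : ℂ)) (I / (β - z * I)) z := by
  rw [← etas_lap β z hβ]
  refine (hasDerivAt_integral_of_dominated_loc_of_deriv_le
    (μ := volume.restrict (Ioi (0:ℝ))) (x₀ := z)
    (F := fun (z : ℝ) (r : ℝ) => (cexp (I * z * r) - 1) * ((Real.exp (-β * r) * r⁻¹ : ℝ) : ℂ))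
    (bound := fun r => 1 * Real.exp (-β * r)) (s := univ)
    (F' := fun z r => I * cexp (I * z * r) * ((Real.exp (-β * r) : ℝ) : ℂ))
    Filter.univ_mem ?_ (etas_int1 β z hβ) ?_ ?_ (etas_exp β hβ 1) ?_).2
  · exact Filter.Eventually.of_forall fun y => (etas_int1 β y hβ).1
  · exact Continuous.aestronglyMeasurable (by fun_prop)
  · refine Filter.Eventually.of_forall fun r y _ => ?_
    rw [norm_mul, norm_mul, etas_cast, Complex.norm_exp_I_mul_ofReal, Complex.norm_real,
      Real.norm_of_nonneg (by positivity)]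
    simp
  · filter_upwards [ae_restrict_mem measurableSet_Ioi] with r hr y _
    have hr' : (r:ℂ) ≠ 0 := by exact_mod_cast (ne_of_gt hr)
    refine (((etas_D r y).cexp.sub_const 1).mul_const
      ((Real.exp (-β * r) * r⁻¹ : ℝ) : ℂ)).congr_deriv ?_
    push_cast; field_simp

lemma etas_der0 (β z : ℝ) (hβ : 0 < β) : HasDerivAt (fun z : ℝ => ∫ r in Ioi (0:ℝ),
    (cexp (I * z * r) - 1 - I * z * r) * ((Real.exp (-β * r) * r ^ (-2 : ℝ) : ℝ) : ℂ))
    (I * ∫ r in Ioi (0:ℝ),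
      (cexp (I * z * r) - 1) * ((Real.exp (-β * r) * r⁻¹ : ℝ) : ℂ)) z := by
  rw [← integral_const_mul]
  refine (hasDerivAt_integral_of_dominated_loc_of_deriv_le
    (μ := volume.restrict (Ioi (0:ℝ))) (x₀ := z)
    (F := fun (z : ℝ) (r : ℝ) => (cexp (I * z * r) - 1 - I * z * r) *
      ((Real.exp (-β * r) * r ^ (-2 : ℝ) : ℝ) : ℂ))
    (bound := fun r => (|z| + 1) * Real.exp (-β * r)) (s := Metric.ball z 1)
    (F' := fun z r => I * ((cexp (I * z * r) - 1) * ((Real.exp (-β * r) * r⁻¹ : ℝ) : ℂ)))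
    (Metric.ball_mem_nhds z one_pos) ?_ (etas_int0 β z hβ) ?_ ?_ (etas_exp β hβ _) ?_).2
  · exact Filter.Eventually.of_forall fun y => (etas_int0 β y hβ).1
  · exact ((etas_int1 β z hβ).const_mul I).1
  · filter_upwards [ae_restrict_mem measurableSet_Ioi] with r hr y hy
    rw [norm_mul, norm_I, one_mul]
    refine (etas_bd1 β y r hr).trans ?_
    gcongr
    rw [Metric.mem_ball, Real.dist_eq] at hy
    have := abs_sub_abs_le_abs_sub y z
    linarith
  · filter_upwards [ae_restrict_mem measurableSet_Ioi] with r hr y _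
    have hr' : (r:ℂ) ≠ 0 := by exact_mod_cast (ne_of_gt hr)
    have h2 : r ^ (-2 : ℝ) = (r ^ 2)⁻¹ := by
      rw [Real.rpow_neg (le_of_lt hr)]; norm_cast
    refine (((((etas_D r y).cexp.sub_const 1).sub (etas_D r y))).mul_const
      ((Real.exp (-β * r) * r ^ (-2 : ℝ) : ℝ) : ℂ)).congr_deriv ?_
    rw [h2]
    push_cast; field_simp

lemma etas_slit (β z : ℝ) (hβ : 0 < β) : (β : ℂ) - z * I ∈ slitPlane :=
  Or.inl (by simpa using hβ)

lemma etas_dlin (β z : ℝ) : HasDerivAt (fun z : ℝ => (β : ℂ) - z * I) (-I) z := by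
  simpa using ((Complex.ofRealCLM.hasDerivAt (x := z)).mul_const I).const_sub (β:ℂ)

lemma etas_dlog (β z : ℝ) (hβ : 0 < β) :
    HasDerivAt (fun z : ℝ => Complex.log ((β : ℂ) - z * I)) (-I / (β - z * I)) z :=
  (etas_dlin β z).clog_real (etas_slit β z hβ)

lemma etas_eq (f g f' : ℝ → ℂ) (hf : ∀ x, HasDerivAt f (f' x) x)
    (hg : ∀ x, HasDerivAt g (f' x) x) (h0 : f 0 = g 0) (x : ℝ) : f x = g x := by
  have hd : ∀ x, HasDerivAt (fun x => f x - g x) 0 x := fun x => by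
    exact ((hf x).sub (hg x)).congr_deriv (sub_self _)
  have := is_const_of_deriv_eq_zero (fun x => (hd x).differentiableAt)
    (fun x => (hd x).deriv) x 0
  simp only [h0, sub_self] at this
  exact sub_eq_zero.mp this

lemma etas_val1 (β z : ℝ) (hβ : 0 < β) : ∫ r in Ioi (0:ℝ),
    (cexp (I * z * r) - 1) * ((Real.exp (-β * r) * r⁻¹ : ℝ) : ℂ)
      = -(Complex.log ((β : ℂ) - z * I) - Complex.log (β : ℂ)) := by
  refine etas_eq _ (fun z : ℝ => -(Complex.log ((β : ℂ) - z * I) - Complex.log (β : ℂ))) _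
    (fun x => etas_der1 β x hβ) (fun x => ?_) (by simp) z
  refine (((etas_dlog β x hβ).sub_const (Complex.log (β : ℂ))).neg).congr_deriv ?_
  ring

theorem etas_charExponent_alpha_eq_one (β z : ℝ) (hβ : 0 < β) :
    IntegrableOn (fun r : ℝ =>
        (Complex.exp (Complex.I * z * r) - 1 - Complex.I * z * r) *
          ((Real.exp (-β * r) * r ^ (-2 : ℝ) : ℝ) : ℂ)) (Set.Ioi 0) volume ∧
    (∫ r in Set.Ioi (0:ℝ),
        (Complex.exp (Complex.I * z * r) - 1 - Complex.I * z * r) *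
          ((Real.exp (-β * r) * r ^ (-2 : ℝ) : ℝ) : ℂ))
      = ((β : ℂ) - z * Complex.I) *
          (Complex.log ((β : ℂ) - z * Complex.I) - Complex.log (β : ℂ))
        + Complex.I * z := by
  refine ⟨etas_int0 β z hβ, ?_⟩
  refine etas_eq _ (fun z : ℝ => ((β : ℂ) - z * Complex.I) *
          (Complex.log ((β : ℂ) - z * Complex.I) - Complex.log (β : ℂ))
        + Complex.I * z) _ (fun x => etas_der0 β x hβ) (fun x => ?_) (by simp) z
  rw [etas_val1 β x hβ]
  have h1 : HasDerivAt (fun t : ℝ => I * (t:ℂ)) I x := by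
    simpa using (Complex.ofRealCLM.hasDerivAt (x := x)).const_mul I
  refine (((etas_dlin β x).mul
    ((etas_dlog β x hβ).sub_const (Complex.log (β : ℂ)))).add h1).congr_deriv ?_
  have hne := slitPlane_ne_zero (etas_slit β x hβ)
  rw [mul_div_cancel₀ _ hne]
  ring
end

section
/- Suppose α ∈ (0,1) and ∫_{S^{d-1}} β(w)^{α−1} λ(dw) < ∞. Then the identity map x ↦ x is Bochner integrable with respect to ν, and the mean vector of ν is ∫_{ℝ^d} x dν(x) = Γ(1−α) ∫_{S^{d-1}} β(w)^{α−1} w λ(dw). -/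
open MeasureTheory Set

lemma etas_radial_integral {α b : ℝ} (h1 : α < 1) (hb : 0 < b) :
    ∫ r in Ioi (0:ℝ), Real.exp (-b * r) * r ^ (-α - 1) * r = b ^ (α - 1) * Real.Gamma (1 - α) := by
  have h := Real.integral_rpow_mul_exp_neg_mul_Ioi (a := 1 - α) (r := b) (by linarith) hb
  have e : (1 / b) ^ (1 - α) = b ^ (α - 1) := by
    rw [one_div, Real.inv_rpow hb.le, ← Real.rpow_neg hb.le]
    congr 1
    ring
  rw [← e, ← h]
  refine setIntegral_congr_fun measurableSet_Ioi fun r hr => ?_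
  have hr' : (0:ℝ) < r := hr
  have : r ^ (1 - α - 1) = r ^ (-α - 1) * r := by
    rw [← Real.rpow_add_one hr'.ne']
    congr 1
    ring
  simp only [this]
  rw [neg_mul]
  ring

lemma etas_radial_integrable {α b : ℝ} (h1 : α < 1) (hb : 0 < b) :
    IntegrableOn (fun r : ℝ => Real.exp (-b * r) * r ^ (-α - 1) * r) (Ioi 0) := by
  by_contra hn
  have h := etas_radial_integral h1 hb
  rw [integral_undef hn] at h
  have h2 := Real.Gamma_pos_of_pos (s := 1 - α) (by linarith)
  have h3 := Real.rpow_pos_of_pos hb (α - 1)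
  have := mul_pos h3 h2
  linarith

lemma etas_eq_map (d : ℕ) (α : ℝ) (lam : Measure (EuclideanSpace ℝ (Fin d))) [IsFiniteMeasure lam]
    (β : EuclideanSpace ℝ (Fin d) → ℝ) (hβ : Measurable β) :
    etas d α lam β = (((lam.prod (volume.restrict (Ioi (0:ℝ)))).withDensity
      (fun p => ENNReal.ofReal (Real.exp (-β p.1 * p.2) * p.2 ^ (-α - 1)))).map
      (fun p => p.2 • p.1)) := by
  have hF : Measurable (fun p : EuclideanSpace ℝ (Fin d) × ℝ =>
      ENNReal.ofReal (Real.exp (-β p.1 * p.2) * p.2 ^ (-α - 1))) := by fun_prop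
  have hm : Measurable (fun p : EuclideanSpace ℝ (Fin d) × ℝ => p.2 • p.1) := by fun_prop
  have key : ∀ s : Set (EuclideanSpace ℝ (Fin d)), MeasurableSet s → ∀ w,
      (radialETaS α (β w)).map (fun r : ℝ => r • w) s =
      ∫⁻ r in Ioi (0:ℝ), ((fun p : EuclideanSpace ℝ (Fin d) × ℝ => p.2 • p.1) ⁻¹' s).indicator
        (fun p => ENNReal.ofReal (Real.exp (-β p.1 * p.2) * p.2 ^ (-α - 1))) (w, r) := by
    intro s hs w
    have hw : Measurable (fun r : ℝ => r • w) := by fun_prop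
    rw [Measure.map_apply hw hs, radialETaS, withDensity_apply _ (hw hs),
      ← lintegral_indicator (hw hs)]
    rfl
  have hmeas : Measurable (fun w => (radialETaS α (β w)).map (fun r : ℝ => r • w)) := by
    refine Measure.measurable_of_measurable_coe _ fun s hs => ?_
    simp_rw [key s hs]
    exact (hF.indicator (hm hs)).lintegral_prod_right'
  ext s hs
  rw [etas, Measure.bind_apply hs hmeas.aemeasurable, Measure.map_apply hm hs,
    withDensity_apply _ (hm hs), ← lintegral_indicator (hm hs),
    lintegral_prod _ (hF.indicator (hm hs)).aemeasurable]
  simp_rw [key s hs]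

/-- if `α ∈ (0,1)` and `∫_{S^{d-1}} β(w)^{α−1} dλ(w) < ∞`, then the
identity map is Bochner integrable w.r.t. `ν` and
`∫_{ℝ^d} x dν(x) = Γ(1−α) ∫_{S^{d-1}} β(w)^{α−1} w dλ(w)`. -/
theorem etas_mean
    (d : ℕ) (hd : 1 ≤ d) (α : ℝ) (hα : α ∈ Set.Ioo (0:ℝ) 2)
    (lam : Measure (EuclideanSpace ℝ (Fin d))) [IsFiniteMeasure lam]
    (hlam : lam (Metric.sphere (0 : EuclideanSpace ℝ (Fin d)) 1)ᶜ = 0)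
    (β : EuclideanSpace ℝ (Fin d) → ℝ) (hβ : Measurable β)
    (hβpos : ∀ w ∈ Metric.sphere (0 : EuclideanSpace ℝ (Fin d)) 1, 0 < β w)
    (hα1 : α ∈ Set.Ioo (0:ℝ) 1)
    (hmom : (∫⁻ w, ENNReal.ofReal (β w ^ (α - 1)) ∂lam) < ⊤) :
    Integrable (fun x : EuclideanSpace ℝ (Fin d) => x) (etas d α lam β) ∧
    (∫ x, x ∂(etas d α lam β))
      = Real.Gamma (1 - α) • ∫ w, (β w ^ (α - 1)) • w ∂lam := by
  have hF : Measurable (fun p : EuclideanSpace ℝ (Fin d) × ℝ =>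
      ENNReal.ofReal (Real.exp (-β p.1 * p.2) * p.2 ^ (-α - 1))) := by fun_prop
  have hm : Measurable (fun p : EuclideanSpace ℝ (Fin d) × ℝ => p.2 • p.1) := by fun_prop
  have hS : ∀ᵐ w ∂lam, ‖w‖ = 1 ∧ 0 < β w := by
    have : ∀ᵐ w ∂lam, w ∈ Metric.sphere (0 : EuclideanSpace ℝ (Fin d)) 1 := hlam
    filter_upwards [this] with w hw
    exact ⟨by simpa using hw, hβpos w hw⟩
  have hβi : Integrable (fun w => β w ^ (α - 1)) lam := by
    refine ⟨(hβ.pow_const (α - 1)).aestronglyMeasurable, ?_⟩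
    rw [hasFiniteIntegral_iff_ofReal]
    · exact hmom
    · filter_upwards [hS] with w hw
      exact (Real.rpow_pos_of_pos hw.2 _).le
  set G : EuclideanSpace ℝ (Fin d) × ℝ → EuclideanSpace ℝ (Fin d) := fun p =>
    (ENNReal.ofReal (Real.exp (-β p.1 * p.2) * p.2 ^ (-α - 1))).toReal • (p.2 • p.1) with hG
  have hGe : ∀ w, ∀ r ∈ Ioi (0:ℝ),
      G (w, r) = (Real.exp (-β w * r) * r ^ (-α - 1) * r) • w := by
    intro w r hr
    have hr' : (0:ℝ) < r := hr
    simp only [hG]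
    rw [ENNReal.toReal_ofReal (by positivity), smul_smul]
  have hGm : Measurable G := hF.ennreal_toReal.smul hm
  have hGi : Integrable G (lam.prod (volume.restrict (Ioi (0:ℝ)))) := by
    rw [integrable_prod_iff hGm.aestronglyMeasurable]
    constructor
    · filter_upwards [hS] with w hw
      have := (etas_radial_integrable hα1.2 hw.2).smul_const w
      exact IntegrableOn.congr_fun this (fun r hr => (hGe w r hr).symm) measurableSet_Ioi
    · refine (hβi.mul_const (Real.Gamma (1 - α))).congr ?_
      filter_upwards [hS] with w hw
      rw [← etas_radial_integral hα1.2 hw.2]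
      refine setIntegral_congr_fun measurableSet_Ioi fun r hr => ?_
      have hr' : (0:ℝ) < r := hr
      simp only [hGe w r hr]
      rw [norm_smul, hw.1, mul_one, Real.norm_of_nonneg (by positivity)]
  rw [etas_eq_map d α lam β hβ]
  constructor
  · rw [integrable_map_measure (by fun_prop) hm.aemeasurable,
      integrable_withDensity_iff_integrable_smul' hF (by simp)]
    exact hGi
  · rw [integral_map hm.aemeasurable (by fun_prop),
      integral_withDensity_eq_integral_toReal_smul hF (by simp)]
    change ∫ p, G p ∂_ = _
    rw [integral_prod _ hGi, ← integral_smul]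
    refine integral_congr_ae ?_
    filter_upwards [hS] with w hw
    rw [setIntegral_congr_fun measurableSet_Ioi (hGe w), integral_smul_const,
      etas_radial_integral hα1.2 hw.2, smul_smul, mul_comm]
end

section
/- Let q > 0, let ρ, σ_h, σ_j, a_h, a_j, μ_h, μ_j, m_Z, v_Z, m_h, m_j, v_h, v_j be real numbers with σ_h, σ_j, a_h, a_j, m_Z, v_Z, m_h, m_j, v_h, v_j > 0 and μ_h, μ_j > 0, and define for t > 0 the time-t correlation ρ_Y(t) = (ρ σ_h σ_j √(a_h a_j) t^q m_Z + μ_h μ_j a_h a_j t^{2q} v_Z) / √((σ_j² t^q m_j + μ_j² t^{2q} v_j)(σ_h² t^q m_h + μ_h² t^{2q} v_h)). Then lim_{t→∞} ρ_Y(t) = a_h a_j v_Z / √(v_h v_j), the correlation of the factor-based subordinator components. -/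
open Filter Real

/-- with all parameters positive and
`ρ_Y(t) = (ρσ_hσ_j√(a_ha_j) t^q m_Z + μ_hμ_j a_h a_j t^{2q} v_Z)
          / √((σ_j²t^q m_j + μ_j²t^{2q} v_j)(σ_h²t^q m_h + μ_h²t^{2q} v_h))`,
one has `lim_{t→∞} ρ_Y(t) = a_h a_j v_Z / √(v_h v_j)`, the correlation of the
factor-based subordinator components. -/
theorem correlation_limit_atTop
    (q ρ σh σj ah aj μh μj mZ vZ mh mj vh vj : ℝ)
    (hq : 0 < q) (hσh : 0 < σh) (hσj : 0 < σj) (hah : 0 < ah) (haj : 0 < aj)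
    (hμh : 0 < μh) (hμj : 0 < μj) (hmZ : 0 < mZ) (hvZ : 0 < vZ)
    (hmh : 0 < mh) (hmj : 0 < mj) (hvh : 0 < vh) (hvj : 0 < vj) :
    Tendsto (fun t : ℝ =>
        (ρ * σh * σj * Real.sqrt (ah * aj) * t ^ q * mZ
            + μh * μj * ah * aj * t ^ (2 * q) * vZ)
          / Real.sqrt ((σj ^ 2 * t ^ q * mj + μj ^ 2 * t ^ (2 * q) * vj)
              * (σh ^ 2 * t ^ q * mh + μh ^ 2 * t ^ (2 * q) * vh)))
      atTop (nhds (ah * aj * vZ / Real.sqrt (vh * vj))) := by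
  have hs : Tendsto (fun t : ℝ => t ^ (-q)) atTop (nhds 0) := tendsto_rpow_neg_atTop hq
  have key : Tendsto (fun s : ℝ =>
      (ρ * σh * σj * Real.sqrt (ah * aj) * s * mZ + μh * μj * ah * aj * vZ)
        / Real.sqrt ((σj ^ 2 * s * mj + μj ^ 2 * vj) * (σh ^ 2 * s * mh + μh ^ 2 * vh)))
      (nhds 0) (nhds (ah * aj * vZ / Real.sqrt (vh * vj))) := by
    have hc : ContinuousAt (fun s : ℝ =>
      (ρ * σh * σj * Real.sqrt (ah * aj) * s * mZ + μh * μj * ah * aj * vZ)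
        / Real.sqrt ((σj ^ 2 * s * mj + μj ^ 2 * vj) * (σh ^ 2 * s * mh + μh ^ 2 * vh))) 0 := by
      apply ContinuousAt.div
      · fun_prop
      · fun_prop
      · apply ne_of_gt
        apply Real.sqrt_pos.mpr
        simp only [mul_zero, zero_mul, zero_add]
        positivity
    have h := hc.tendsto
    have e : (ρ * σh * σj * Real.sqrt (ah * aj) * 0 * mZ + μh * μj * ah * aj * vZ)
        / Real.sqrt ((σj ^ 2 * 0 * mj + μj ^ 2 * vj) * (σh ^ 2 * 0 * mh + μh ^ 2 * vh))
        = ah * aj * vZ / Real.sqrt (vh * vj) := by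
      have e1 : (σj ^ 2 * 0 * mj + μj ^ 2 * vj) * (σh ^ 2 * 0 * mh + μh ^ 2 * vh)
          = (μh * μj) ^ 2 * (vh * vj) := by ring
      rw [e1, Real.sqrt_mul (sq_nonneg (μh * μj)), Real.sqrt_sq (by positivity)]
      have : 0 < Real.sqrt (vh * vj) := Real.sqrt_pos.mpr (by positivity)
      field_simp
      ring
    rw [e] at h
    exact h
  refine (key.comp hs).congr' ?_
  filter_upwards [eventually_gt_atTop 0] with t ht
  have hx : 0 < t ^ q := Real.rpow_pos_of_pos ht q
  have h2 : t ^ (2 * q) = (t ^ q) ^ 2 := by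
    rw [mul_comm, Real.rpow_mul ht.le]; norm_cast
  simp only [Function.comp]
  rw [h2, Real.rpow_neg ht.le]
  generalize t ^ q = x at hx
  have e1 : (σj ^ 2 * x * mj + μj ^ 2 * x ^ 2 * vj) * (σh ^ 2 * x * mh + μh ^ 2 * x ^ 2 * vh)
      = (x ^ 2) ^ 2 * ((σj ^ 2 * x⁻¹ * mj + μj ^ 2 * vj) * (σh ^ 2 * x⁻¹ * mh + μh ^ 2 * vh)) := by
    field_simp
  have e2 : ρ * σh * σj * Real.sqrt (ah * aj) * x * mZ + μh * μj * ah * aj * x ^ 2 * vZ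
      = x ^ 2 * (ρ * σh * σj * Real.sqrt (ah * aj) * x⁻¹ * mZ + μh * μj * ah * aj * vZ) := by
    field_simp
  rw [e1, e2, Real.sqrt_mul (sq_nonneg (x ^ 2)), Real.sqrt_sq (by positivity),
    mul_div_mul_left _ _ (by positivity)]
end

section
/- Let q > 0, let ρ, σ_h, σ_j, a_h, a_j, μ_h, μ_j, m_Z, v_Z, m_h, m_j, v_h, v_j be real numbers with σ_h, σ_j, a_h, a_j, m_Z, v_Z, m_h, m_j, v_h, v_j > 0 and μ_h, μ_j > 0, and define for t > 0 the time-t correlation ρ_Y(t) = (ρ σ_h σ_j √(a_h a_j) t^q m_Z + μ_h μ_j a_h a_j t^{2q} v_Z) / √((σ_j² t^q m_j + μ_j² t^{2q} v_j)(σ_h² t^q m_h + μ_h² t^{2q} v_h)). Then lim_{t→0+} ρ_Y(t) = ρ √(a_h a_j) m_Z / √(m_h m_j). -/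
open Filter Real

/-- with all parameters positive and
`ρ_Y(t) = (ρσ_hσ_j√(a_ha_j) t^q m_Z + μ_hμ_j a_h a_j t^{2q} v_Z)
          / √((σ_j²t^q m_j + μ_j²t^{2q} v_j)(σ_h²t^q m_h + μ_h²t^{2q} v_h))`,
one has `lim_{t→0+} ρ_Y(t) = ρ √(a_h a_j) m_Z / √(m_h m_j)`. -/
theorem correlation_limit_zero
    (q ρ σh σj ah aj μh μj mZ vZ mh mj vh vj : ℝ)
    (hq : 0 < q) (hσh : 0 < σh) (hσj : 0 < σj) (hah : 0 < ah) (haj : 0 < aj)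
    (hμh : 0 < μh) (hμj : 0 < μj) (hmZ : 0 < mZ) (hvZ : 0 < vZ)
    (hmh : 0 < mh) (hmj : 0 < mj) (hvh : 0 < vh) (hvj : 0 < vj) :
    Tendsto (fun t : ℝ =>
        (ρ * σh * σj * Real.sqrt (ah * aj) * t ^ q * mZ
            + μh * μj * ah * aj * t ^ (2 * q) * vZ)
          / Real.sqrt ((σj ^ 2 * t ^ q * mj + μj ^ 2 * t ^ (2 * q) * vj)
              * (σh ^ 2 * t ^ q * mh + μh ^ 2 * t ^ (2 * q) * vh)))
      (nhdsWithin 0 (Set.Ioi 0)) (nhds (ρ * Real.sqrt (ah * aj) * mZ / Real.sqrt (mh * mj))) := by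
  have hx : Tendsto (fun t : ℝ => t ^ q) (nhdsWithin 0 (Set.Ioi 0)) (nhds 0) := by
    have h := (Real.continuousAt_rpow_const 0 q (Or.inr hq.le)).tendsto
    rw [Real.zero_rpow hq.ne'] at h
    exact h.mono_left nhdsWithin_le_nhds
  have hm : 0 < Real.sqrt (mh * mj) := Real.sqrt_pos.mpr (mul_pos hmh hmj)
  have hs : Real.sqrt ((σj ^ 2 * mj + μj ^ 2 * 0 * vj) * (σh ^ 2 * mh + μh ^ 2 * 0 * vh))
      = σh * σj * Real.sqrt (mh * mj) := by
    rw [show (σj ^ 2 * mj + μj ^ 2 * 0 * vj) * (σh ^ 2 * mh + μh ^ 2 * 0 * vh)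
      = (σh * σj) ^ 2 * (mh * mj) by ring, Real.sqrt_mul (by positivity),
      Real.sqrt_sq (by positivity)]
  have hc : ContinuousAt (fun x : ℝ =>
      (ρ * σh * σj * Real.sqrt (ah * aj) * mZ + μh * μj * ah * aj * x * vZ)
        / Real.sqrt ((σj ^ 2 * mj + μj ^ 2 * x * vj) * (σh ^ 2 * mh + μh ^ 2 * x * vh))) 0 := by
    apply ContinuousAt.div
    · fun_prop
    · fun_prop
    · rw [hs]
      positivity
  have key := hc.tendsto.comp hx
  simp only [hs] at key
  have he : (ρ * σh * σj * Real.sqrt (ah * aj) * mZ + μh * μj * ah * aj * 0 * vZ)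
      / (σh * σj * Real.sqrt (mh * mj)) = ρ * Real.sqrt (ah * aj) * mZ / Real.sqrt (mh * mj) := by
    field_simp
    ring
  rw [he] at key
  refine key.congr' ?_
  filter_upwards [self_mem_nhdsWithin] with t ht
  have ht0 : (0 : ℝ) < t := ht
  have hp : 0 < t ^ q := Real.rpow_pos_of_pos ht0 q
  have h2 : t ^ (2 * q) = t ^ q * t ^ q := by rw [two_mul, Real.rpow_add ht0]
  simp only [Function.comp, h2]
  generalize t ^ q = x at hp
  rw [show (σj ^ 2 * x * mj + μj ^ 2 * (x * x) * vj) * (σh ^ 2 * x * mh + μh ^ 2 * (x * x) * vh)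
    = x ^ 2 * ((σj ^ 2 * mj + μj ^ 2 * x * vj) * (σh ^ 2 * mh + μh ^ 2 * x * vh)) by ring,
    Real.sqrt_mul (sq_nonneg x), Real.sqrt_sq hp.le,
    show ρ * σh * σj * Real.sqrt (ah * aj) * x * mZ + μh * μj * ah * aj * (x * x) * vZ
    = x * (ρ * σh * σj * Real.sqrt (ah * aj) * mZ + μh * μj * ah * aj * x * vZ) by ring,
    mul_div_mul_left _ _ hp.ne']
end
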